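/- For every integer n ≥ 3, Σ_{k=3}^{n} φ(k) · S^{(3)}_{n,k} = 2·p(n−3), where p denotes the partition function. -/

import Mathlib

open Finset

/-- `S r n k` is the total number of parts equal to `k`, counted with
multiplicity, over all partitions of `n` whose parts are all at least `r`. -/
def S (r n k : ℕ) : ℕ :=
  ∑ P ∈ Finset.univ.filter (fun P : n.Partition => ∀ p ∈ P.parts, r ≤ p),
    Multiset.count k P.parts

/-- Partitions of `n` containing the part `k` correspond to partitions of `n - k`. -/
lemma sum_partition_ite_mem {n k : ℕ} (hk : 1 ≤ k) (hkn : k ≤ n) (f : Multiset ℕ → ℕ) :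
    ∑ P : n.Partition, (if k ∈ P.parts then f P.parts else 0)
      = ∑ P : (n - k).Partition, f (k ::ₘ P.parts) := by
  rw [← Finset.sum_filter, Finset.sum_subtype (p := fun P : n.Partition => k ∈ P.parts)
    (Finset.univ.filter fun P : n.Partition => k ∈ P.parts) (by simp)]
  refine Fintype.sum_equiv (Nat.Partition.partitionWithPartEquiv hk hkn) _ _ fun P => ?_
  rw [Nat.Partition.partitionWithPartEquiv_apply_parts, Multiset.cons_erase P.2]

/-- The number of partitions of `n` whose parts are all at least `r`. -/
def cardPartsGe (r n : ℕ) : ℕ :=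
  #{P : n.Partition | ∀ p ∈ P.parts, r ≤ p}

lemma cardPartsGe_one (n : ℕ) : cardPartsGe 1 n = Fintype.card n.Partition := by
  rw [cardPartsGe, Finset.filter_true_of_mem fun P _ _ => P.parts_pos, Finset.card_univ]

lemma cardPartsGe_eq_add {r : ℕ} (hr : 1 ≤ r) (n : ℕ) :
    cardPartsGe r n = cardPartsGe (r + 1) n + if r ≤ n then cardPartsGe r (n - r) else 0 := by
  have split : cardPartsGe r n = cardPartsGe (r + 1) n +
      ∑ P : n.Partition, if r ∈ P.parts then (if ∀ p ∈ P.parts, r ≤ p then 1 else 0) else 0 := by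
    simp only [cardPartsGe, Finset.card_filter, ← Finset.sum_add_distrib]
    refine Finset.sum_congr rfl fun P _ => ?_
    by_cases hmem : r ∈ P.parts
    · have : ¬ ∀ p ∈ P.parts, r + 1 ≤ p := fun h => by have := h r hmem; omega
      simp only [hmem, this, if_true, if_false, zero_add]
    · have : (∀ p ∈ P.parts, r + 1 ≤ p) ↔ ∀ p ∈ P.parts, r ≤ p := by
        refine forall₂_congr fun p hp => ?_
        have : p ≠ r := fun h => hmem (h ▸ hp)
        omega
      simp only [hmem, this, if_false, add_zero]
  rw [split]
  congr 1
  split_ifs with hrn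
  · rw [sum_partition_ite_mem hr hrn (fun s => if ∀ p ∈ s, r ≤ p then 1 else 0)]
    simp [cardPartsGe]
  · exact Finset.sum_eq_zero fun P _ =>
      if_neg fun h => hrn (Nat.Partition.le_of_mem_parts h)

lemma S_eq_add {r k : ℕ} (hk : 1 ≤ k) (hrk : r ≤ k) (n : ℕ) :
    S r n k = if k ≤ n then cardPartsGe r (n - k) + S r (n - k) k else 0 := by
  have restrict : S r n k = ∑ P : n.Partition, if k ∈ P.parts then
      (if ∀ p ∈ P.parts, r ≤ p then P.parts.count k else 0) else 0 := by
    rw [S, Finset.sum_filter]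
    refine Finset.sum_congr rfl fun P _ => ?_
    by_cases hmem : k ∈ P.parts
    · simp only [hmem, if_true]
    · simp [hmem]
  rw [restrict]
  split_ifs with hkn
  · rw [sum_partition_ite_mem hk hkn (fun s => if ∀ p ∈ s, r ≤ p then s.count k else 0)]
    simp only [cardPartsGe, S, Finset.card_filter, Finset.sum_filter, ← Finset.sum_add_distrib]
    refine Finset.sum_congr rfl fun P _ => ?_
    simp only [Multiset.mem_cons, forall_eq_or_imp, hrk, true_and, Multiset.count_cons_self]
    split_ifs <;> omega
  · exact Finset.sum_eq_zero fun P _ =>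
      if_neg fun h => hkn (Nat.Partition.le_of_mem_parts h)

open PowerSeries

/-- The generating function of `cardPartsGe r`. -/
noncomputable def partsGeSeries (r : ℕ) : ℤ⟦X⟧ := .mk fun n => (cardPartsGe r n : ℤ)

/-- The series `X ^ k / (1 - X ^ k)`. -/
noncomputable def multiplesSeries (k : ℕ) : ℤ⟦X⟧ := .mk fun n => if n ≠ 0 ∧ k ∣ n then 1 else 0

lemma partsGeSeries_mul_one_sub {r : ℕ} (hr : 1 ≤ r) :
    partsGeSeries r * (1 - X ^ r) = partsGeSeries (r + 1) := by
  ext n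
  rw [mul_sub, mul_one, map_sub, coeff_mul_X_pow']
  simp only [partsGeSeries, coeff_mk]
  rw [cardPartsGe_eq_add hr n]
  push_cast
  split_ifs <;> ring

lemma multiplesSeries_mul_one_sub {k : ℕ} (hk : 1 ≤ k) :
    multiplesSeries k * (1 - X ^ k) = X ^ k := by
  ext n
  rw [mul_sub, mul_one, map_sub, coeff_mul_X_pow', coeff_X_pow]
  simp only [multiplesSeries, coeff_mk]
  by_cases hkn : k ≤ n
  · obtain ⟨m, rfl⟩ := Nat.exists_eq_add_of_le hkn
    by_cases hm : m = 0
    · subst hm; simp; omega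
    · simp [hm]
  · have : ¬ (n ≠ 0 ∧ k ∣ n) := fun ⟨h0, hd⟩ => hkn (Nat.le_of_dvd (by omega) hd)
    have hne : n ≠ k := by omega
    simp only [hkn, this, hne, if_false, sub_zero]

lemma mk_S_eq {r k : ℕ} (hk : 1 ≤ k) (hrk : r ≤ k) :
    (.mk fun n => (S r n k : ℤ) : ℤ⟦X⟧) = multiplesSeries k * partsGeSeries r := by
  have hne : (1 - X ^ k : ℤ⟦X⟧) ≠ 0 := fun h => by
    have := congrArg (coeff 0) h
    simp [show k ≠ 0 by omega] at this
  refine mul_right_cancel₀ hne ?_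
  rw [mul_right_comm, multiplesSeries_mul_one_sub hk]
  ext n
  rw [mul_sub, mul_one, map_sub, coeff_mul_X_pow', coeff_X_pow_mul']
  simp only [partsGeSeries, coeff_mk]
  rw [S_eq_add hk hrk n]
  split_ifs
  · push_cast; ring
  · simp

lemma sum_totient_Icc_three {n a : ℕ} (han : a ≤ n) (hn : 3 ≤ n) :
    ∑ k ∈ Finset.Icc 3 n, (if a ≠ 0 ∧ k ∣ a then Nat.totient k else 0) = 2 * ((a - 1) / 2) := by
  rcases Nat.eq_zero_or_pos a with rfl | ha
  · simp
  have divs : a.divisors = (Finset.Icc 1 n).filter (a ≠ 0 ∧ · ∣ a) := by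
    ext d
    simp only [Nat.mem_divisors, Finset.mem_filter, Finset.mem_Icc]
    exact ⟨fun ⟨h, h0⟩ => ⟨⟨Nat.pos_of_dvd_of_pos h ha, (Nat.le_of_dvd ha h).trans han⟩, h0, h⟩,
      fun h => ⟨h.2.2, h.2.1⟩⟩
  have total := Nat.sum_totient a
  rw [divs, Finset.sum_filter, ← Finset.add_sum_Ioc_eq_sum_Icc (by omega),
    ← Finset.Icc_add_one_left_eq_Ioc, ← Finset.add_sum_Ioc_eq_sum_Icc (by omega),
    ← Finset.Icc_add_one_left_eq_Ioc] at total
  norm_num [ha.ne'] at total ⊢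
  split_ifs at total <;> omega

/-- `∑ 2⌊(n - 1) / 2⌋ X ^ n = 2 X ^ 3 / ((1 - X) (1 - X ^ 2))`. -/
lemma mk_two_mul_half_mul :
    (.mk fun n => ((2 * ((n - 1) / 2) : ℕ) : ℤ) : ℤ⟦X⟧) * ((1 - X ^ 1) * (1 - X ^ 2))
      = X ^ 3 * 2 := by
  rw [show ((1 - X ^ 1) * (1 - X ^ 2) : ℤ⟦X⟧) = 1 - X ^ 1 - X ^ 2 + X ^ 3 by ring]
  ext n
  have two : (2 : ℤ⟦X⟧) = C 2 := by simp
  rw [mul_add, mul_sub, mul_sub, mul_one, map_add, map_sub, map_sub, coeff_mul_X_pow',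
    coeff_mul_X_pow', coeff_mul_X_pow', two, coeff_mul_C, coeff_X_pow]
  simp only [coeff_mk]
  split_ifs <;> omega

/-- for `n ≥ 3`, `Σ_{k=3}^{n} φ(k) · S^{(3)}_{n,k} = 2·p(n−3)`. -/
theorem totient_S_three_sum (n : ℕ) (hn : 3 ≤ n) :
    ∑ k ∈ Finset.Icc 3 n, Nat.totient k * S 3 n k
      = 2 * Fintype.card (Nat.Partition (n - 3)) := by
  have expand : ∀ k ∈ Finset.Icc 3 n, ((Nat.totient k * S 3 n k : ℕ) : ℤ) =
      ∑ x ∈ antidiagonal n, ((if x.1 ≠ 0 ∧ k ∣ x.1 then Nat.totient k else 0 : ℕ) : ℤ) *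
        cardPartsGe 3 x.2 := fun k hk => by
    have hk3 := (Finset.mem_Icc.mp hk).1
    have := congrArg (coeff n) (mk_S_eq (r := 3) (k := k) (by omega) hk3)
    rw [coeff_mk, coeff_mul] at this
    rw [Nat.cast_mul, this, Finset.mul_sum]
    refine Finset.sum_congr rfl fun x _ => ?_
    simp only [multiplesSeries, partsGeSeries, coeff_mk]
    split_ifs <;> simp
  have series : (.mk fun n => ((2 * ((n - 1) / 2) : ℕ) : ℤ) : ℤ⟦X⟧) * partsGeSeries 3
      = X ^ 3 * (C 2 * partsGeSeries 1) := by
    rw [← partsGeSeries_mul_one_sub (r := 2) (by omega),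
      ← partsGeSeries_mul_one_sub (r := 1) le_rfl, mul_assoc, mul_left_comm,
      mk_two_mul_half_mul, show (C 2 : ℤ⟦X⟧) = 2 by simp]
    ring
  have coeffs := congrArg (coeff n) series
  rw [coeff_mul, coeff_X_pow_mul', if_pos hn, coeff_C_mul] at coeffs
  simp only [partsGeSeries, coeff_mk, cardPartsGe_one] at coeffs
  zify
  rw [← coeffs]
  push_cast at expand ⊢
  rw [Finset.sum_congr rfl expand, Finset.sum_comm]
  refine Finset.sum_congr rfl fun x hx => ?_
  have hxn : x.1 ≤ n := HasAntidiagonal.antidiagonal.fst_le hx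
  rw [← Finset.sum_mul]
  congr 1
  have := sum_totient_Icc_three hxn hn
  zify at this
  exact_mod_cast this
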